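/- Let (R,m) be a Noetherian local ring, let (S,n) be a Noetherian local ring that is an integral ring extension of R, and let M be an S-module. If c ∈ R is a colon-killer for M over R, then there exists N ≥ 1 such that c^N is a colon-killer for M over S. -/

import Mathlib

open IsLocalRing

universe u v w

/-- `x` is a system of parameters of the local ring `R`: a sequence of `dim R` elements
of the maximal ideal generating an ideal primary to the maximal ideal. -/
def IsSOP (R : Type*) [CommRing R] [IsLocalRing R] {n : ℕ} (x : Fin n → R) : Prop :=
  (n : WithBot ℕ∞) = ringKrullDim R ∧
  (∀ i, x i ∈ maximalIdeal R) ∧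
  (Ideal.span (Set.range x)).radical = maximalIdeal R

/-- The sequence `x` of elements of `R` is a regular sequence on the `R`-module `M`. -/
def IsRegSeq (R : Type*) [CommRing R] (M : Type*) [AddCommGroup M] [Module R M]
    {n : ℕ} (x : Fin n → R) : Prop :=
  RingTheory.Sequence.IsRegular M (List.ofFn x)

/-- `B` is a big Cohen-Macaulay algebra over the local ring `R`: some system of
parameters of `R` is a regular sequence on `B` (and in particular `mB ≠ B`). -/
def IsBigCM (R : Type*) [CommRing R] [IsLocalRing R]
    (B : Type*) [CommRing B] [Algebra R B] : Prop :=
  (∃ (n : ℕ) (x : Fin n → R), IsSOP R x ∧ IsRegSeq R B x) ∧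
  (maximalIdeal R).map (algebraMap R B) ≠ ⊤

/-- `B` is a balanced big Cohen-Macaulay algebra over the local ring `R`: every system of
parameters of `R` is a regular sequence on `B` (and in particular `mB ≠ B`). -/
def IsBalancedBigCM (R : Type*) [CommRing R] [IsLocalRing R]
    (B : Type*) [CommRing B] [Algebra R B] : Prop :=
  (∀ (n : ℕ) (x : Fin n → R), IsSOP R x → IsRegSeq R B x) ∧
  (maximalIdeal R).map (algebraMap R B) ≠ ⊤

/-- `S` is a seed over the local ring `R`: `S` admits an `R`-algebra homomorphism to some
big Cohen-Macaulay `R`-algebra. -/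
def IsSeed (R : Type u) [CommRing R] [IsLocalRing R]
    (S : Type v) [CommRing S] [Algebra R S] : Prop :=
  ∃ (B : Type (max u v)) (_ : CommRing B) (_ : Algebra R B),
    IsBigCM R B ∧ Nonempty (S →ₐ[R] B)

/-- `x` is an initial segment of a system of parameters of `R`. -/
def IsPartialSOP (R : Type*) [CommRing R] [IsLocalRing R] {n : ℕ} (x : Fin n → R) : Prop :=
  ∃ (d : ℕ) (hnd : n ≤ d) (y : Fin d → R), IsSOP R y ∧ ∀ i : Fin n, y (Fin.castLE hnd i) = x i

/-- For an `R`-algebra `T` and a `T`-module `M`, the element `c ∈ T` is a colon-killer for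
`M` over the local ring `R`: `c·((x_1,…,x_k)M :_M x_{k+1}) ⊆ (x_1,…,x_k)M` for every
partial system of parameters `x_1,…,x_{k+1}` of `R`. -/
def IsColonKiller (R : Type*) [CommRing R] [IsLocalRing R]
    (T : Type*) [CommRing T] [Algebra R T]
    (M : Type*) [AddCommGroup M] [Module T M] (c : T) : Prop :=
  ∀ (k : ℕ) (x : Fin (k + 1) → R), IsPartialSOP R x → ∀ m : M,
    algebraMap R T (x (Fin.last k)) • m ∈
        (Ideal.span (Set.range fun i : Fin k => algebraMap R T (x i.castSucc))) •
          (⊤ : Submodule T M) →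
      c • m ∈
        (Ideal.span (Set.range fun i : Fin k => algebraMap R T (x i.castSucc))) •
          (⊤ : Submodule T M)

section Koszul

/-- Linear maps preserve membership in the submodules `I • ⊤`. -/
theorem LinearMap.map_mem_smul_top {S : Type*} [CommRing S] {X Y : Type*} [AddCommGroup X]
    [AddCommGroup Y] [Module S X] [Module S Y] (f : X →ₗ[S] Y) {I : Ideal S} {z : X}
    (hz : z ∈ I • (⊤ : Submodule S X)) : f z ∈ I • (⊤ : Submodule S Y) :=
  Submodule.smul_top_le_comap_smul_top I f hz

theorem Prod.mem_smul_top_iff {S : Type*} [CommRing S] {X Y : Type*} [AddCommGroup X]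
    [AddCommGroup Y] [Module S X] [Module S Y] {I : Ideal S} {z : X × Y} :
    z ∈ I • (⊤ : Submodule S (X × Y)) ↔
      z.1 ∈ I • (⊤ : Submodule S X) ∧ z.2 ∈ I • (⊤ : Submodule S Y) := by
  refine ⟨fun h => ⟨(LinearMap.fst S X Y).map_mem_smul_top h,
    (LinearMap.snd S X Y).map_mem_smul_top h⟩, fun h => ?_⟩
  have := Submodule.add_mem _ ((LinearMap.inl S X Y).map_mem_smul_top h.1)
    ((LinearMap.inr S X Y).map_mem_smul_top h.2)
  simpa using this

theorem Ideal.span_range_fin_succ {S : Type*} [CommRing S] {n : ℕ} (y : Fin (n + 1) → S) :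
    Ideal.span (Set.range y) =
      Ideal.span (Set.range fun i : Fin n => y i.castSucc) ⊔ Ideal.span {y (Fin.last n)} := by
  rw [← Ideal.span_union]
  congr 1
  ext a
  simp only [Set.mem_range, Set.mem_union, Set.mem_singleton_iff, Fin.exists_fin_succ',
    eq_comm (a := a)]

/-- The total module of the Koszul complex of `y` on `M`, with its differential `d`, the
contracting homotopies `h a` for multiplication by `∑ a i * y i`, the filtration `fil` by the
submodules of chains of degree at least `i`, and the inclusion and projection of the degree zero
part. -/
structure KoszulModel (S : Type v) [CommRing S] (M : Type w) [AddCommGroup M] [Module S M]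
    {n : ℕ} (y : Fin n → S) where
  X : Type w
  [addCommGroup : AddCommGroup X]
  [module : Module S X]
  d : X →ₗ[S] X
  h : (Fin n → S) → X →ₗ[S] X
  fil : ℕ → Submodule S X
  incl : M →ₗ[S] X
  proj : X →ₗ[S] M
  d_d : ∀ z, d (d z) = 0
  homotopy : ∀ a z, d (h a z) + h a (d z) = (∑ i, a i * y i) • z
  fil_zero : fil 0 = ⊤
  fil_eq_bot : ∀ i, n < i → fil i = ⊥
  h_mem : ∀ a i z, z ∈ fil i → h a z ∈ fil (i + 1)
  proj_incl : ∀ m, proj (incl m) = m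
  d_incl : ∀ m, d (incl m) = 0
  proj_d : ∀ z, proj (d z) ∈ Ideal.span (Set.range y) • (⊤ : Submodule S M)
  lift : ∀ m ∈ Ideal.span (Set.range y) • (⊤ : Submodule S M), ∃ a ∈ fil 1, d a = incl m
  colon : ∀ (I : Ideal S) (x c : S),
    (∀ m : M, x • m ∈ I • (⊤ : Submodule S M) → c • m ∈ I • (⊤ : Submodule S M)) →
    ∀ z : X, x • z ∈ I • (⊤ : Submodule S X) → c • z ∈ I • (⊤ : Submodule S X)

namespace KoszulModel

attribute [instance] KoszulModel.addCommGroup KoszulModel.module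

variable {S : Type v} [CommRing S] {M : Type w} [AddCommGroup M] [Module S M]

/-- The Koszul complex of the empty sequence. -/
def nil (y : Fin 0 → S) : KoszulModel S M y where
  X := M
  d := 0
  h := 0
  fil i := if i = 0 then ⊤ else ⊥
  incl := LinearMap.id
  proj := LinearMap.id
  d_d := by simp
  homotopy := by simp
  fil_zero := by simp
  fil_eq_bot i hi := by simp [hi.ne']
  h_mem := by simp
  proj_incl := by simp
  d_incl := by simp
  proj_d := by simp
  lift := by simp
  colon I x c hyp := hyp

/-- The Koszul complex of `y` is the cone of multiplication by the last entry of `y` on the Koszul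
complex of the other entries. -/
def snoc {n : ℕ} (y : Fin (n + 1) → S) (K : KoszulModel S M fun i : Fin n => y i.castSucc) :
    KoszulModel S M y where
  X := K.X × K.X
  d := (K.d.coprod (y (Fin.last n) • LinearMap.id)).prod (-K.d ∘ₗ LinearMap.snd S K.X K.X)
  h a := (K.h (fun i => a i.castSucc) ∘ₗ LinearMap.fst S K.X K.X).prod
    ((a (Fin.last n) • LinearMap.id).coprod (-K.h (fun i => a i.castSucc)))
  fil i := match i with
    | 0 => ⊤
    | i + 1 => (K.fil (i + 1)).prod (K.fil i)
  incl := LinearMap.inl S K.X K.X ∘ₗ K.incl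
  proj := K.proj ∘ₗ LinearMap.fst S K.X K.X
  d_d z := by
    ext <;> simp [K.d_d]
  homotopy a z := by
    have h1 := K.homotopy (fun i => a i.castSucc) z.1
    have h2 := K.homotopy (fun i => a i.castSucc) z.2
    rw [Fin.sum_univ_castSucc, add_smul]
    ext
    · simp only [LinearMap.prod_apply, Function.prod, LinearMap.coprod_apply, LinearMap.comp_apply,
        LinearMap.fst_apply, LinearMap.snd_apply, LinearMap.smul_apply, LinearMap.id_apply,
        LinearMap.neg_apply, Prod.fst_add, Prod.smul_fst, map_add, map_smul, ← h1]
      module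
    · simp only [LinearMap.prod_apply, Function.prod, LinearMap.coprod_apply, LinearMap.comp_apply,
        LinearMap.fst_apply, LinearMap.snd_apply, LinearMap.smul_apply, LinearMap.id_apply,
        LinearMap.neg_apply, Prod.snd_add, Prod.smul_snd, map_add, map_smul, map_neg, ← h2]
      module
  fil_zero := rfl
  fil_eq_bot i hi := by
    obtain _ | i := i
    · omega
    · simp [K.fil_eq_bot (i + 1) (by omega), K.fil_eq_bot i (by omega)]
  h_mem a i z hz := by
    obtain _ | i := i
    · have := K.h_mem (fun i => a i.castSucc) 0 z.1 (by simp [K.fil_zero])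
      simpa [Submodule.mem_prod, K.fil_zero] using this
    · exact ⟨K.h_mem _ _ _ hz.1, Submodule.add_mem _ (Submodule.smul_mem _ _ hz.1)
        (Submodule.neg_mem _ (K.h_mem _ _ _ hz.2))⟩
  proj_incl m := by simp [K.proj_incl]
  d_incl m := by simp [K.d_incl]
  proj_d z := by
    rw [Ideal.span_range_fin_succ, Submodule.sup_smul]
    simp only [LinearMap.prod_apply, Function.prod, LinearMap.coprod_apply, LinearMap.comp_apply,
      LinearMap.fst_apply, LinearMap.smul_apply, LinearMap.id_apply, map_add, map_smul]
    exact Submodule.add_mem_sup (K.proj_d _)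
      (Submodule.smul_mem_smul (Ideal.mem_span_singleton_self _) trivial)
  lift m hm := by
    rw [Ideal.span_range_fin_succ, Submodule.sup_smul] at hm
    obtain ⟨m₁, hm₁, m₂, hm₂, rfl⟩ := Submodule.mem_sup.mp hm
    rw [Submodule.ideal_span_singleton_smul] at hm₂
    obtain ⟨m₂, -, rfl⟩ := (Submodule.mem_smul_pointwise_iff_exists _ _ _).mp hm₂
    obtain ⟨a, ha, hda⟩ := K.lift m₁ hm₁
    exact ⟨(a, K.incl m₂), ⟨ha, by simp [K.fil_zero]⟩, by ext <;> simp [hda, K.d_incl]⟩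
  colon I x c hyp z hz := by
    rw [Prod.mem_smul_top_iff] at hz ⊢
    exact ⟨K.colon I x c hyp _ hz.1, K.colon I x c hyp _ hz.2⟩

/-- The Koszul complex of any finite sequence. -/
def ofFn : {n : ℕ} → (y : Fin n → S) → KoszulModel S M y
  | 0, y => nil y
  | _ + 1, y => snoc y (ofFn _)

/-- If `c` kills the colons of a sequence `x` in the ideal generated by `y`, then a power of `c`
turns each cycle of degree at least `j + 1` modulo the first `j` entries of `x` into a boundary. -/
theorem exists_smul_sub_d_mem {n : ℕ} {y : Fin n → S} (K : KoszulModel S M y) (c : S)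
    (x : ℕ → S) (hx : ∀ j < n, x j ∈ Ideal.span (Set.range y))
    (hc : ∀ j < n, ∀ m : M,
      x j • m ∈ Ideal.span (Set.range fun i : Fin j => x i) • (⊤ : Submodule S M) →
      c • m ∈ Ideal.span (Set.range fun i : Fin j => x i) • (⊤ : Submodule S M))
    {r j : ℕ} (hr : j + r = n) {z : K.X} (hz : z ∈ K.fil (j + 1))
    (hdz : K.d z ∈ Ideal.span (Set.range fun i : Fin j => x i) • (⊤ : Submodule S K.X)) :
    ∃ u, c ^ r • z - K.d u ∈
      Ideal.span (Set.range fun i : Fin j => x i) • (⊤ : Submodule S K.X) := by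
  induction r generalizing j z with
  | zero =>
    rw [K.fil_eq_bot _ (by omega), Submodule.mem_bot] at hz
    exact ⟨0, by simp [hz]⟩
  | succ r ih =>
    have hspan : Ideal.span (Set.range fun i : Fin (j + 1) => x i) =
        Ideal.span (Set.range fun i : Fin j => x i) ⊔ Ideal.span {x j} :=
      Ideal.span_range_fin_succ fun i : Fin (j + 1) => x i
    obtain ⟨a, ha⟩ := (Submodule.mem_span_range_iff_exists_fun S).mp (hx j (by omega))
    have hhom := K.homotopy a z
    simp only [smul_eq_mul] at ha
    rw [ha] at hhom
    have hh : K.h a (K.d z) ∈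
        Ideal.span (Set.range fun i : Fin j => x i) • (⊤ : Submodule S K.X) :=
      (K.h a).map_mem_smul_top hdz
    obtain ⟨v, hv⟩ := ih (j := j + 1) (by omega) (K.h_mem a _ z hz) <| by
      rw [hspan, Submodule.sup_smul, eq_sub_of_add_eq hhom, sub_eq_neg_add]
      exact Submodule.add_mem_sup (Submodule.neg_mem _ hh)
        (Submodule.smul_mem_smul (Ideal.mem_span_singleton_self _) trivial)
    rw [hspan, Submodule.sup_smul] at hv
    obtain ⟨t, ht, u, hu, htu⟩ := Submodule.mem_sup.mp hv
    rw [Submodule.ideal_span_singleton_smul] at hu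
    obtain ⟨u, -, rfl⟩ := (Submodule.mem_smul_pointwise_iff_exists _ _ _).mp hu
    have hdt := K.d.map_mem_smul_top ht
    have key : x j • (c ^ r • z - K.d u) = K.d t + c ^ r • K.h a (K.d z) := by
      have := congrArg K.d htu
      simp only [map_add, map_sub, map_smul, K.d_d, sub_zero] at this
      rw [eq_sub_of_add_eq hhom] at this
      rw [eq_sub_of_add_eq this]
      module
    refine ⟨c • u, ?_⟩
    have := K.colon _ _ _ (hc j (by omega)) (c ^ r • z - K.d u) <| by
      rw [key]
      exact Submodule.add_mem _ hdt (Submodule.smul_mem _ _ hh)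
    rwa [smul_sub, smul_smul, ← pow_succ', ← map_smul] at this

end KoszulModel

/-- If `c` kills the colons of a sequence of length `n + 1` contained in the ideal generated by
`y 0, …, y n`, then `c ^ (n + 1)` kills the last colon of `y`. -/
theorem pow_smul_mem_of_forall_colon {S : Type v} [CommRing S] {M : Type w} [AddCommGroup M]
    [Module S M] {n : ℕ} (y : Fin (n + 1) → S) (c : S) (x : ℕ → S)
    (hx : ∀ j < n + 1, x j ∈ Ideal.span (Set.range y))
    (hc : ∀ j < n + 1, ∀ m : M,
      x j • m ∈ Ideal.span (Set.range fun i : Fin j => x i) • (⊤ : Submodule S M) →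
      c • m ∈ Ideal.span (Set.range fun i : Fin j => x i) • (⊤ : Submodule S M))
    (m : M) (hm : y (Fin.last n) • m ∈
      Ideal.span (Set.range fun i : Fin n => y i.castSucc) • (⊤ : Submodule S M)) :
    c ^ (n + 1) • m ∈
      Ideal.span (Set.range fun i : Fin n => y i.castSucc) • (⊤ : Submodule S M) := by
  let K : KoszulModel S M fun i : Fin n => y i.castSucc := KoszulModel.ofFn _
  obtain ⟨a, ha, hda⟩ := K.lift _ hm
  obtain ⟨u, hu⟩ := (K.snoc y).exists_smul_sub_d_mem c x hx hc (r := n + 1) (j := 0)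
    (z := (-a, K.incl m)) (by omega)
    ⟨Submodule.neg_mem _ ha, by simp [K.fil_zero]⟩ (by
      have : (K.snoc y).d (-a, K.incl m) = 0 :=
        Prod.ext (show K.d (-a) + y (Fin.last n) • K.incl m = 0 by simp [hda])
          (show -K.d (K.incl m) = 0 by simp [K.d_incl])
      rw [this]
      exact Submodule.zero_mem _)
  have hu' : c ^ (n + 1) • (show (K.snoc y).X from (-a, K.incl m)) - (K.snoc y).d u = 0 := by
    simpa using hu
  have h2 : c ^ (n + 1) • K.incl m - -K.d u.2 = 0 := congrArg Prod.snd hu'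
  have h3 := congrArg K.proj (sub_eq_zero.mp h2)
  rw [map_smul, K.proj_incl, map_neg] at h3
  rw [h3]
  exact Submodule.neg_mem _ (K.proj_d _)

end Koszul

section Parameters

open Order

theorem PrimeSpectrum.coheight_comap_of_isIntegral {R S : Type*} [CommRing R] [CommRing S]
    [Algebra R S] [Algebra.IsIntegral R S] (Q : PrimeSpectrum S) :
    coheight (PrimeSpectrum.comap (algebraMap R S) Q) = coheight Q := by
  refine (coheight_eq_of_strictMono (PrimeSpectrum.comap (algebraMap R S))
    (fun I J h => Ideal.IsIntegral.comap_lt_comap h) (fun Q P hP => ?_) Q).symm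
  have : Q.asIdeal.LiesOver (PrimeSpectrum.comap (algebraMap R S) Q).asIdeal := ⟨rfl⟩
  obtain ⟨Q', hQ, hQ', hP'⟩ := Ideal.exists_ideal_gt_liesOver_of_lt Q.asIdeal hP
  exact ⟨⟨Q', hQ'⟩, hQ, PrimeSpectrum.ext hP'.over.symm⟩

theorem ringKrullDim_eq_of_isIntegral {R S : Type*} [CommRing R] [CommRing S]
    [Algebra R S] [Algebra.IsIntegral R S] (hinj : Function.Injective (algebraMap R S)) :
    ringKrullDim R = ringKrullDim S := by
  refine le_antisymm ?_ (krullDim_le_of_strictMono (PrimeSpectrum.comap (algebraMap R S))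
    fun I J h => Ideal.IsIntegral.comap_lt_comap h)
  rw [ringKrullDim, krullDim_eq_iSup_coheight]
  refine iSup_le fun P => ?_
  obtain ⟨Q, -, hQ, hQP⟩ := Ideal.exists_ideal_over_prime_of_isIntegral P.asIdeal (⊥ : Ideal S)
    (by rw [← RingHom.ker_eq_comap_bot, (RingHom.injective_iff_ker_eq_bot _).mp hinj]; exact bot_le)
  have : P = PrimeSpectrum.comap (algebraMap R S) ⟨Q, hQ⟩ := PrimeSpectrum.ext hQP.symm
  rw [this, PrimeSpectrum.coheight_comap_of_isIntegral]
  exact coheight_le_krullDim _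

/-- All primes containing `I` have coheight at most `e`; equivalently, `dim R ⧸ I ≤ e`. -/
def CoheightLE {R : Type*} [CommRing R] (I : Ideal R) (e : ℕ) : Prop :=
  ∀ P : PrimeSpectrum R, I ≤ P.asIdeal → coheight P ≤ e

theorem CoheightLE.comap {R S : Type*} [CommRing R] [CommRing S] [Algebra R S]
    [Algebra.IsIntegral R S] {I : Ideal S} {e : ℕ} (h : CoheightLE I e) :
    CoheightLE (I.comap (algebraMap R S)) e := by
  intro P hP
  obtain ⟨Q, hIQ, hQ, hQP⟩ := Ideal.exists_ideal_over_prime_of_isIntegral P.asIdeal I hP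
  have : P = PrimeSpectrum.comap (algebraMap R S) ⟨Q, hQ⟩ := PrimeSpectrum.ext hQP.symm
  rw [this, PrimeSpectrum.coheight_comap_of_isIntegral]
  exact h _ hIQ

/-- Cutting down the dimension of `R ⧸ I` by an element of `J`. -/
theorem CoheightLE.exists_mem {R : Type*} [CommRing R] [IsNoetherianRing R] {I J : Ideal R}
    {e : ℕ} (hI : CoheightLE I (e + 1)) (hJ : CoheightLE J e) :
    ∃ x ∈ J, CoheightLE (I ⊔ Ideal.span {x}) e := by
  have hfin : {P ∈ I.minimalPrimes | ¬ J ≤ P}.Finite :=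
    (Ideal.finite_minimalPrimes_of_isNoetherianRing R I).subset fun _ h => h.1
  obtain ⟨x, hxJ, hx⟩ : ∃ x ∈ J, ∀ P ∈ I.minimalPrimes, ¬ J ≤ P → x ∉ P := by
    by_contra! hcon
    obtain ⟨P, hP, hJP⟩ := (Ideal.subset_union_prime (s := hfin.toFinset) (f := id) ⊤ ⊤
      (fun P hP _ _ => ((Set.Finite.mem_toFinset _).mp hP).1.1.1) (I := J)).mp fun x hx => by
        obtain ⟨P, hP, hJP, hxP⟩ := hcon x hx
        simp only [Set.mem_iUnion]
        exact ⟨P, by simpa using ⟨hP, hJP⟩, hxP⟩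
    exact ((Set.Finite.mem_toFinset _).mp hP).2 hJP
  refine ⟨x, hxJ, fun Q hQ => ?_⟩
  obtain ⟨hIQ, hxQ⟩ := sup_le_iff.mp hQ
  rw [Ideal.span_singleton_le_iff_mem] at hxQ
  obtain ⟨P, hP, hPQ⟩ := Ideal.exists_minimalPrimes_le hIQ
  by_cases hJP : J ≤ P
  · exact hJ Q (hJP.trans hPQ)
  · have hlt : (⟨P, hP.1.1⟩ : PrimeSpectrum R) < Q :=
      lt_of_le_of_ne hPQ fun h => hx P hP hJP (by rwa [← h] at hxQ)
    have := (coheight_add_one_le hlt).trans (hI ⟨P, hP.1.1⟩ hP.1.2)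
    push_cast at this
    exact (ENat.add_le_add_iff_right ENat.one_ne_top).mp this

theorem CoheightLE.exists_fin {R : Type*} [CommRing R] [IsNoetherianRing R] {I J : Ideal R}
    {e n : ℕ} (hI : CoheightLE I (e + n)) (hJ : CoheightLE J e) :
    ∃ x : Fin n → R, (∀ i, x i ∈ J) ∧ CoheightLE (I ⊔ Ideal.span (Set.range x)) e := by
  induction n generalizing I with
  | zero => exact ⟨Fin.elim0, fun i => i.elim0, by simpa using hI⟩
  | succ n ih =>
    obtain ⟨a, ha, hIa⟩ := CoheightLE.exists_mem (e := e + n) hI fun P hP =>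
      (hJ P hP).trans (by exact_mod_cast Nat.le_add_right e n)
    obtain ⟨x, hx, hIx⟩ := ih hIa
    refine ⟨Fin.cons a x, Fin.cases ha hx, ?_⟩
    rwa [Fin.range_cons, Set.insert_eq, Ideal.span_union, ← sup_assoc]

theorem CoheightLE.radical_eq {R : Type*} [CommRing R] [IsLocalRing R] {I : Ideal R}
    (hI : CoheightLE I 0) (hle : I ≤ maximalIdeal R) : I.radical = maximalIdeal R := by
  refine le_antisymm ((IsLocalRing.maximalIdeal.isMaximal R).isPrime.radical_le_iff.mpr hle) ?_
  rw [Ideal.radical_eq_sInf]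
  refine le_sInf fun P hP => ?_
  have h0 : coheight (⟨P, hP.2⟩ : PrimeSpectrum R) = 0 := by simpa using hI ⟨P, hP.2⟩ hP.1
  have := coheight_eq_zero.mp h0
  rw [PrimeSpectrum.isMax_iff] at this
  exact (IsLocalRing.eq_maximalIdeal this).ge

/-- An ideal `J` with `dim R ⧸ J ≤ dim R - n` contains `n` elements of a system of parameters. -/
theorem CoheightLE.exists_isPartialSOP {R : Type*} [CommRing R] [IsLocalRing R]
    [IsNoetherianRing R] {J : Ideal R} {n e : ℕ} (hJ : CoheightLE J e)
    (hle : J ≤ maximalIdeal R) (hd : ((n + e : ℕ) : WithBot ℕ∞) = ringKrullDim R) :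
    ∃ x : Fin n → R, (∀ i, x i ∈ J) ∧ IsPartialSOP R x := by
  have hbot : CoheightLE (⊥ : Ideal R) (e + n) := fun P _ => by
    have := coheight_le_krullDim P
    rw [← ringKrullDim, ← hd, add_comm n e] at this
    exact_mod_cast this
  have hmax : CoheightLE (maximalIdeal R) 0 := fun P hP => by
    have : IsMax P := (PrimeSpectrum.isMax_iff).mpr <| by
      rw [← (IsLocalRing.maximalIdeal.isMaximal R).eq_of_le P.2.ne_top hP]
      infer_instance
    simp [coheight_eq_zero.mpr this]
  obtain ⟨x, hxJ, hx⟩ := hbot.exists_fin hJ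
  obtain ⟨x', hx'm, hx'⟩ := CoheightLE.exists_fin (n := e) (by rwa [zero_add]) hmax
  have hm : ∀ i, Fin.append x x' i ∈ maximalIdeal R := fun i => by
    refine Fin.addCases (fun i => ?_) (fun i => ?_) i
    · simpa using hle (hxJ i)
    · simpa using hx'm i
  refine ⟨x, hxJ, n + e, Nat.le_add_right n e, Fin.append x x', ⟨hd, hm, ?_⟩, fun i =>
    Fin.append_left x x' i⟩
  refine CoheightLE.radical_eq ?_ (Ideal.span_le.mpr (Set.range_subset_iff.mpr hm))
  rwa [bot_sup_eq, ← Ideal.span_union, ← Set.Sum.elim_range, ← Fin.append_comp_sumElim,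
    Set.range_comp, show Set.range (Sum.elim (Fin.castAdd e) (Fin.natAdd n)) = Set.univ from
      finSumFinEquiv.range_eq_univ, Set.image_univ] at hx'

/-- If `x` consists of `n` elements of a system of parameters of length `n + e`, then
`dim S ⧸ (x) ≤ e`. -/
theorem IsSOP.coheightLE {S : Type*} [CommRing S] [IsLocalRing S] [IsNoetherianRing S]
    {n e : ℕ} {y : Fin (n + e) → S} (hy : IsSOP S y) :
    CoheightLE (Ideal.span (Set.range fun i : Fin n => y (Fin.castAdd e i))) e := by
  intro P hP
  rw [← WithBot.coe_le_coe, coheight_eq_krullDim_Ici]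
  have hIci : krullDim (Set.Ici P) = ringKrullDim (S ⧸ P.asIdeal) :=
    (ringKrullDim_quotient P.asIdeal).symm
  have : IsLocalRing (S ⧸ P.asIdeal) :=
    IsLocalRing.of_surjective' _ Ideal.Quotient.mk_surjective
  rw [hIci, ← IsLocalRing.maximalIdeal_height_eq_ringKrullDim, WithBot.coe_le_coe]
  let z : Fin e → S ⧸ P.asIdeal := fun i => Ideal.Quotient.mk _ (y (Fin.natAdd n i))
  have hcomap : (maximalIdeal (S ⧸ P.asIdeal)).comap (Ideal.Quotient.mk P.asIdeal) =
      maximalIdeal S :=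
    IsLocalRing.eq_maximalIdeal
      (Ideal.comap_isMaximal_of_surjective _ Ideal.Quotient.mk_surjective)
  have hz : maximalIdeal (S ⧸ P.asIdeal) ∈ (Ideal.span (Set.range z)).minimalPrimes := by
    refine ⟨⟨inferInstance, Ideal.span_le.mpr (Set.range_subset_iff.mpr fun i => ?_)⟩,
      fun Q hQ _ w hw => ?_⟩
    · have := hy.2.1 (Fin.natAdd n i)
      rwa [← hcomap] at this
    · obtain ⟨s, rfl⟩ := Ideal.Quotient.mk_surjective w
      have := hQ.1
      have hyQ : Ideal.span (Set.range y) ≤ Q.comap (Ideal.Quotient.mk P.asIdeal) := by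
        refine Ideal.span_le.mpr (Set.range_subset_iff.mpr fun i => ?_)
        refine Fin.addCases (fun i => ?_) (fun i => ?_) i
        · have : y (Fin.castAdd e i) ∈ P.asIdeal := hP (Ideal.subset_span ⟨i, rfl⟩)
          simp [Ideal.Quotient.eq_zero_iff_mem.mpr this]
        · exact hQ.2 (Ideal.subset_span ⟨i, rfl⟩)
      have hs : s ∈ maximalIdeal S := hcomap ▸ hw
      rw [← hy.2.2] at hs
      exact (Ideal.IsPrime.radical_le_iff inferInstance).mpr hyQ hs
  refine (Ideal.height_le_card_of_mem_minimalPrimes_span (Set.finite_range z) hz).trans ?_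
  rw [← Set.image_univ]
  exact_mod_cast (Set.ncard_image_le Set.finite_univ).trans (by simp)

theorem IsPartialSOP.exists_comap {R S : Type*} [CommRing R] [IsLocalRing R] [IsNoetherianRing R]
    [CommRing S] [IsLocalRing S] [IsNoetherianRing S] [Algebra R S] [Algebra.IsIntegral R S]
    (hinj : Function.Injective (algebraMap R S)) {n : ℕ} {y : Fin n → S} (hy : IsPartialSOP S y) :
    ∃ x : Fin n → R, IsPartialSOP R x ∧ ∀ i, algebraMap R S (x i) ∈ Ideal.span (Set.range y) := by
  obtain ⟨d, hnd, z, hz, hzy⟩ := hy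
  obtain ⟨e, rfl⟩ := Nat.exists_eq_add_of_le hnd
  obtain rfl : y = fun i => z (Fin.castAdd e i) := funext fun i => (hzy i).symm
  have hle : Ideal.span (Set.range fun i => z (Fin.castAdd e i)) ≠ ⊤ := fun h =>
    (IsLocalRing.maximalIdeal.isMaximal S).ne_top <| top_le_iff.mp <| h ▸
      Ideal.span_le.mpr (Set.range_subset_iff.mpr fun i => hz.2.1 _)
  obtain ⟨x, hx, hpx⟩ := (hz.coheightLE.comap (R := R)).exists_isPartialSOP (n := n)
    (IsLocalRing.le_maximalIdeal (Ideal.comap_ne_top _ hle))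
    (hz.1.trans (ringKrullDim_eq_of_isIntegral hinj).symm)
  exact ⟨x, hpx, hx⟩

theorem IsPartialSOP.castLE {R : Type*} [CommRing R] [IsLocalRing R] {n m : ℕ} {x : Fin n → R}
    (hx : IsPartialSOP R x) (h : m ≤ n) : IsPartialSOP R fun i : Fin m => x (Fin.castLE h i) := by
  obtain ⟨d, hnd, y, hy, hyx⟩ := hx
  exact ⟨d, h.trans hnd, y, hy, fun i => hyx (Fin.castLE h i)⟩

end Parameters

/-- **Proposition (Dietz, Prop. 4.3 / `ckbasechange`).** Let `(S,n)` be a Noetherian local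
ring that is an integral extension of a Noetherian local ring `(R,m)`, and let `M` be an
`S`-module. If `c ∈ R` is a colon-killer for `M` over `R`, then some power `c^N` is a
colon-killer for `M` over `S`. -/
theorem colon_killer_of_integral_extension
    (R : Type u) [CommRing R] [IsLocalRing R] [IsNoetherianRing R]
    (S : Type v) [CommRing S] [IsLocalRing S] [IsNoetherianRing S]
    [Algebra R S] (hinj : Function.Injective (algebraMap R S)) [Algebra.IsIntegral R S]
    (M : Type w) [AddCommGroup M] [Module S M]
    (c : R) (hc : IsColonKiller R S M (algebraMap R S c)) :
    ∃ N : ℕ, 1 ≤ N ∧ IsColonKiller S S M (algebraMap R S c ^ N) := by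
  by_cases hd : ∃ d : ℕ, (d : WithBot ℕ∞) = ringKrullDim S
  swap
  · exact ⟨1, le_rfl, fun k x hx => (hd (hx.elim fun d h => ⟨d, h.elim fun _ h =>
      h.elim fun _ h => h.1.1⟩)).elim⟩
  obtain ⟨d, hd⟩ := hd
  refine ⟨d + 1, Nat.le_add_left 1 d, fun k y hy m hm => ?_⟩
  have hkd : k + 1 ≤ d + 1 := by
    obtain ⟨d', hkd, z, hz, -⟩ := hy
    have : d' = d := by exact_mod_cast hz.1.trans hd.symm
    omega
  obtain ⟨x, hx, hxy⟩ := hy.exists_comap (R := R) hinj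
  let x' : ℕ → R := fun i => if h : i < k + 1 then x ⟨i, h⟩ else 0
  have hx' : ∀ i (h : i < k + 1), x' i = x ⟨i, h⟩ := fun i h => dif_pos h
  rw [← Nat.sub_add_cancel hkd, pow_add, mul_smul]
  refine Submodule.smul_mem _ _ ?_
  refine pow_smul_mem_of_forall_colon y (algebraMap R S c) (fun i => algebraMap R S (x' i))
    (fun j hj => ?_) (fun j hj m hm => ?_) m hm
  · rw [hx' j hj]
    exact hxy _
  · refine hc j (fun i => x' i) ?_ m hm
    convert hx.castLE (Nat.succ_le_of_lt hj) using 2 with i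
    exact hx' _ _
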